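/- arXiv:1911.06723 — 4 statements merged into one kernel-verified Lean document; each statement's English description precedes it below -/
import Mathlib

section
/- Let μ₁ and μ₂ be probability measures on ℝ with finite means m(μ₁) and m(μ₂), satisfying the balance condition T_{μ₁}(m(μ₁)) = T_{μ₂}(m(μ₂)). If m(μ₂) < m(μ₁) and μ₁ assigns positive measure to the half-open interval [m(μ₂), m(μ₁)), then T_{μ₂}(m(μ₁)) < T_{μ₁}(m(μ₂)); in particular, the dominance inequality T_{μ₁}(m(μ₂)) ≤ T_{μ₂}(m(μ₁)) does not hold. -/
open MeasureTheory

/-- The mean of a measure on ℝ. -/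
noncomputable def distMean (μ : Measure ℝ) : ℝ := ∫ x, x ∂μ

/-- The upper-tail probability of a measure on ℝ at threshold `t`. -/
noncomputable def tailProb (μ : Measure ℝ) (t : ℝ) : ENNReal := μ {x | t ≤ x}

/-- Backward direction of Proposition 2 (contrapositive form): if the mean of `μ₂`
is strictly smaller than that of `μ₁` and `μ₁` has mass between the two means, then
the dominance inequality `tailProb μ₁ (distMean μ₂) ≤ tailProb μ₂ (distMean μ₁)` fails. -/
theorem mean_lt_imp_not_dominates
    (μ₁ μ₂ : Measure ℝ) [IsProbabilityMeasure μ₁] [IsProbabilityMeasure μ₂]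
    (hint₁ : Integrable id μ₁) (hint₂ : Integrable id μ₂)
    (hbal : tailProb μ₁ (distMean μ₁) = tailProb μ₂ (distMean μ₂))
    (hmean : distMean μ₂ < distMean μ₁)
    (hmass : 0 < μ₁ (Set.Ico (distMean μ₂) (distMean μ₁))) :
    tailProb μ₂ (distMean μ₁) < tailProb μ₁ (distMean μ₂) ∧
      ¬ (tailProb μ₁ (distMean μ₂) ≤ tailProb μ₂ (distMean μ₁)) := by
  have h1 : tailProb μ₂ (distMean μ₁) ≤ tailProb μ₂ (distMean μ₂) :=
    measure_mono fun x (hx : distMean μ₁ ≤ x) => hmean.le.trans hx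
  have h2 : tailProb μ₁ (distMean μ₂)
      = μ₁ (Set.Ico (distMean μ₂) (distMean μ₁)) + tailProb μ₁ (distMean μ₁) := by
    unfold tailProb
    change μ₁ (Set.Ici _) = _ + μ₁ (Set.Ici _)
    rw [← measure_union _ measurableSet_Ici, Set.Ico_union_Ici_eq_Ici hmean.le]
    exact Set.disjoint_left.2 fun x hx hx' => absurd hx.2 (not_lt.2 hx')
  have h3 : tailProb μ₂ (distMean μ₁) < tailProb μ₁ (distMean μ₂) := by
    rw [h2, add_comm]
    refine (h1.trans hbal.symm.le).trans_lt ?_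
    exact ENNReal.lt_add_right (measure_ne_top _ _) hmass.ne'
  exact ⟨h3, not_le.2 h3⟩
end

section
/- Let μ₁ and μ₂ be probability measures on ℝ with finite means m(μ₁) and m(μ₂), satisfying the balance condition T_{μ₁}(m(μ₁)) = T_{μ₂}(m(μ₂)), and suppose μ₁ has full support in the sense that μ₁ assigns positive measure to every nonempty open interval of ℝ. Then m(μ₁) ≤ m(μ₂) if and only if T_{μ₁}(m(μ₂)) ≤ T_{μ₂}(m(μ₁)) (i.e., if and only if μ₂ dominates μ₁). -/
open MeasureTheory

/-- A measure on ℝ has full support: positive measure on every nonempty open interval. -/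
def FullSupport (μ : Measure ℝ) : Prop := ∀ a b : ℝ, a < b → 0 < μ (Set.Ioo a b)

/-- Proposition 2 (both directions): under the balance condition and a full-support
hypothesis on `μ₁`, the mean comparison characterizes dominance. -/
theorem mean_le_iff_dominates
    (μ₁ μ₂ : Measure ℝ) [IsProbabilityMeasure μ₁] [IsProbabilityMeasure μ₂]
    (hint₁ : Integrable id μ₁) (hint₂ : Integrable id μ₂)
    (hbal : tailProb μ₁ (distMean μ₁) = tailProb μ₂ (distMean μ₂))
    (hsupp : FullSupport μ₁) :
    distMean μ₁ ≤ distMean μ₂ ↔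
      tailProb μ₁ (distMean μ₂) ≤ tailProb μ₂ (distMean μ₁) := by
  have anti : ∀ (μ : Measure ℝ) {a b : ℝ}, a ≤ b → tailProb μ b ≤ tailProb μ a := by
    intro μ a b hab
    exact measure_mono (fun x (hx : b ≤ x) => le_trans hab hx)
  constructor
  · intro h
    calc tailProb μ₁ (distMean μ₂) ≤ tailProb μ₁ (distMean μ₁) := anti μ₁ h
      _ = tailProb μ₂ (distMean μ₂) := hbal
      _ ≤ tailProb μ₂ (distMean μ₁) := anti μ₂ h
  · intro h
    by_contra hlt
    rw [not_le] at hlt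
    have h1 : tailProb μ₁ (distMean μ₂) ≤ tailProb μ₁ (distMean μ₁) :=
      h.trans ((anti μ₂ hlt.le).trans hbal.ge)
    have h2 : tailProb μ₁ (distMean μ₁) + μ₁ (Set.Ioo (distMean μ₂) (distMean μ₁))
        ≤ tailProb μ₁ (distMean μ₂) := by
      unfold tailProb
      rw [← measure_union _ measurableSet_Ioo]
      · apply measure_mono
        rintro x (hx | hx)
        · exact hlt.le.trans hx
        · exact hx.1.le
      · rw [Set.disjoint_left]
        intro x hx hx'
        exact absurd hx'.2 (not_lt.mpr hx)
    have h3 : tailProb μ₁ (distMean μ₁) <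
        tailProb μ₁ (distMean μ₁) + μ₁ (Set.Ioo (distMean μ₂) (distMean μ₁)) :=
      ENNReal.lt_add_right (measure_ne_top _ _) (hsupp _ _ hlt).ne'
    exact absurd (h3.trans_le (h2.trans h1)) (lt_irrefl _)
end

section
/- Let μ₁, μ₂, μ₃ be probability measures on ℝ with finite means m(μ₁), m(μ₂), m(μ₃), such that the central tail probabilities T_{μ₁}(m(μ₁)) = T_{μ₂}(m(μ₂)) = T_{μ₃}(m(μ₃)) are all equal, and suppose μ₁ and μ₂ each have full support (positive measure on every nonempty open interval of ℝ). If μ₂ dominates μ₁ (T_{μ₁}(m(μ₂)) ≤ T_{μ₂}(m(μ₁))) and μ₃ dominates μ₂ (T_{μ₂}(m(μ₃)) ≤ T_{μ₃}(m(μ₂))), then μ₃ dominates μ₁ (T_{μ₁}(m(μ₃)) ≤ T_{μ₃}(m(μ₁))). -/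
open MeasureTheory

theorem tailProb_antitone (μ : Measure ℝ) {a b : ℝ} (h : a ≤ b) :
    tailProb μ b ≤ tailProb μ a :=
  measure_mono fun _ hx => le_trans h hx

theorem tailProb_lt (μ : Measure ℝ) [IsProbabilityMeasure μ] (hs : FullSupport μ)
    {a b : ℝ} (h : a < b) : tailProb μ b < tailProb μ a := by
  have hd : Disjoint {x : ℝ | b ≤ x} (Set.Ioo a b) :=
    Set.disjoint_left.mpr fun x hx hx' => absurd hx'.2 (not_lt.mpr hx)
  have hle : μ ({x : ℝ | b ≤ x} ∪ Set.Ioo a b) ≤ tailProb μ a := by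
    apply measure_mono
    rintro x (hx | hx)
    · exact le_trans h.le hx
    · exact hx.1.le
  rw [measure_union hd measurableSet_Ioo] at hle
  exact lt_of_lt_of_le (ENNReal.lt_add_right (measure_ne_top μ _) (hs a b h).ne') hle

theorem mean_le_of_dominates (μ ν : Measure ℝ) [IsProbabilityMeasure μ] (hs : FullSupport μ)
    (hb : tailProb μ (distMean μ) = tailProb ν (distMean ν))
    (hd : tailProb μ (distMean ν) ≤ tailProb ν (distMean μ)) : distMean μ ≤ distMean ν := by
  by_contra hc
  have hlt := not_le.mp hc
  have h1 := tailProb_lt μ hs hlt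
  have h2 := tailProb_antitone ν hlt.le
  rw [hb] at h1
  exact absurd (hd.trans h2) (not_le.mpr h1)

/-- Proposition 3: transitivity of the dominant-distribution relation. -/
theorem dominant_trans
    (μ₁ μ₂ μ₃ : Measure ℝ)
    [IsProbabilityMeasure μ₁] [IsProbabilityMeasure μ₂] [IsProbabilityMeasure μ₃]
    (hint₁ : Integrable id μ₁) (hint₂ : Integrable id μ₂) (hint₃ : Integrable id μ₃)
    (hbal₁₂ : tailProb μ₁ (distMean μ₁) = tailProb μ₂ (distMean μ₂))
    (hbal₂₃ : tailProb μ₂ (distMean μ₂) = tailProb μ₃ (distMean μ₃))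
    (hsupp₁ : FullSupport μ₁) (hsupp₂ : FullSupport μ₂)
    (hdom₁₂ : tailProb μ₁ (distMean μ₂) ≤ tailProb μ₂ (distMean μ₁))
    (hdom₂₃ : tailProb μ₂ (distMean μ₃) ≤ tailProb μ₃ (distMean μ₂)) :
    tailProb μ₁ (distMean μ₃) ≤ tailProb μ₃ (distMean μ₁) := by
  have h12 := mean_le_of_dominates μ₁ μ₂ hsupp₁ hbal₁₂ hdom₁₂
  have h23 := mean_le_of_dominates μ₂ μ₃ hsupp₂ hbal₂₃ hdom₂₃
  have h13 := h12.trans h23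
  calc tailProb μ₁ (distMean μ₃) ≤ tailProb μ₁ (distMean μ₁) := tailProb_antitone μ₁ h13
    _ = tailProb μ₃ (distMean μ₃) := hbal₁₂.trans hbal₂₃
    _ ≤ tailProb μ₃ (distMean μ₁) := tailProb_antitone μ₃ h13
end

section
/- Let μ₀, μ₁, …, μ_n be a finite sequence of probability measures on ℝ, each with finite mean and full support (positive measure on every nonempty open interval of ℝ), and suppose there is a constant c such that T_{μ_i}(m(μ_i)) = c for every i. If μ_i ⪯ μ_{i+1} for every 0 ≤ i < n (i.e., T_{μ_i}(m(μ_{i+1})) ≤ T_{μ_{i+1}}(m(μ_i)) for each consecutive pair), then μ₀ ⪯ μ_n, i.e., T_{μ₀}(m(μ_n)) ≤ T_{μ_n}(m(μ₀)). -/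
open MeasureTheory

theorem tailProb_antitone_aux (ν : Measure ℝ) {a b : ℝ} (h : a ≤ b) :
    tailProb ν b ≤ tailProb ν a :=
  measure_mono (fun _ hx => le_trans h hx)

theorem tailProb_strict_aux (ν : Measure ℝ) [IsProbabilityMeasure ν] (hs : FullSupport ν)
    {a b : ℝ} (h : a < b) : tailProb ν b < tailProb ν a := by
  have hd : Disjoint (Set.Ioo a b) {x | b ≤ x} := by
    rw [Set.disjoint_left]
    intro x hx hx'
    exact absurd hx.2 (not_lt.mpr hx')
  have hu : ν (Set.Ioo a b ∪ {x | b ≤ x}) = ν (Set.Ioo a b) + ν {x | b ≤ x} :=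
    measure_union hd measurableSet_Ici
  have hle : ν (Set.Ioo a b ∪ {x | b ≤ x}) ≤ ν {x | a ≤ x} := by
    apply measure_mono
    rintro x (hx | hx)
    · exact hx.1.le
    · exact le_trans h.le hx
  unfold tailProb
  refine lt_of_lt_of_le ?_ (hu ▸ hle)
  rw [add_comm]
  exact ENNReal.lt_add_right (measure_ne_top ν _) (hs a b h).ne'

/-- Chain extension of Proposition 3: along a finite chain of consecutive dominations,
the last distribution dominates the first. -/
theorem dominant_chain
    (n : ℕ) (μ : ℕ → Measure ℝ) (c : ENNReal)
    (hprob : ∀ i, IsProbabilityMeasure (μ i))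
    (hint : ∀ i, Integrable id (μ i))
    (hsupp : ∀ i, FullSupport (μ i))
    (hbal : ∀ i, tailProb (μ i) (distMean (μ i)) = c)
    (hchain : ∀ i < n,
      tailProb (μ i) (distMean (μ (i + 1))) ≤ tailProb (μ (i + 1)) (distMean (μ i))) :
    tailProb (μ 0) (distMean (μ n)) ≤ tailProb (μ n) (distMean (μ 0)) := by
  have step : ∀ i < n, distMean (μ i) ≤ distMean (μ (i + 1)) := by
    intro i hi
    by_contra hlt
    have hlt := not_le.mp hlt
    haveI := hprob i
    have h1 := tailProb_strict_aux (μ i) (hsupp i) hlt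
    have h2 := tailProb_antitone_aux (μ (i + 1)) hlt.le
    rw [hbal] at h1 h2
    exact absurd (lt_of_lt_of_le h1 ((hchain i hi).trans h2)) (lt_irrefl _)
  have all : ∀ k ≤ n, distMean (μ 0) ≤ distMean (μ k) := by
    intro k
    induction k with
    | zero => intro _; exact le_rfl
    | succ k ih => intro hk; exact (ih (by omega)).trans (step k (by omega))
  have h := all n le_rfl
  have h1 := tailProb_antitone_aux (μ 0) h
  have h2 := tailProb_antitone_aux (μ n) h
  rw [hbal] at h1 h2
  exact h1.trans h2
end
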